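/- arXiv:1009.5618 — 4 statements merged into one kernel-verified Lean document; each statement's English description precedes it below -/
import Mathlib

section
/- Let E be a finite-dimensional real inner product space. The square-root map a ↦ a^{1/2}, defined on the set of positive definite self-adjoint endomorphisms of E and sending a to its unique positive definite self-adjoint square root, is real analytic; that is, as a map from the real normed space of self-adjoint endomorphisms of E to itself, it is analytic at every positive definite self-adjoint endomorphism. -/
open scoped RealInnerProductSpace

theorem aux_sylv {E : Type*} [NormedAddCommGroup E] [InnerProductSpace ℝ E]
    [FiniteDimensional ℝ E] (s t h : E →L[ℝ] E)
    (hs : ∀ x : E, x ≠ 0 → 0 < ⟪s x, x⟫) (ht : ∀ x : E, x ≠ 0 → 0 < ⟪t x, x⟫)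
    (hh : ∀ x y : E, ⟪h x, y⟫ = ⟪x, h y⟫) (heq : s * h + h * t = 0) : h = 0 := by
  have hsym : (h : E →ₗ[ℝ] E).IsSymmetric := fun x y => hh x y
  have key : (h : E →ₗ[ℝ] E) = 0 := by
    refine (hsym.eigenvectorBasis rfl).toBasis.ext fun i => ?_
    rw [OrthonormalBasis.coe_toBasis]
    have hv := hsym.apply_eigenvectorBasis rfl i
    have hne : hsym.eigenvectorBasis rfl i ≠ 0 := (hsym.eigenvectorBasis rfl).orthonormal.ne_zero i
    generalize hsym.eigenvectorBasis rfl i = x at *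
    generalize hsym.eigenvalues rfl i = μ at *
    have hv' : h x = μ • x := by simpa using hv
    have h1 : s (h x) + h (t x) = 0 := by simpa using congrArg (fun f : E →L[ℝ] E => f x) heq
    have h2 : ⟪s (h x) + h (t x), x⟫ = 0 := by rw [h1, inner_zero_left]
    rw [inner_add_left, hh, hv', map_smul, inner_smul_left, inner_smul_right] at h2
    have h3 : μ * (⟪s x, x⟫ + ⟪t x, x⟫) = 0 := by simpa [mul_add] using h2
    have h4 : μ = 0 := by
      have := hs x hne
      have := ht x hne
      rcases mul_eq_zero.1 h3 with h | h
      · exact h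
      · linarith
    rw [hv, h4]; simp
  ext x
  exact congrArg (fun f : E →ₗ[ℝ] E => f x) key

theorem aux_open {E : Type*} [NormedAddCommGroup E] [InnerProductSpace ℝ E]
    [FiniteDimensional ℝ E] (b : E →L[ℝ] E)
    (hb : ∀ x : E, x ≠ 0 → 0 < ⟪b x, x⟫) :
    ∀ᶠ s in nhds b, ∀ x : E, x ≠ 0 → 0 < ⟪s x, x⟫ := by
  have h1 : ∀ᶠ s in nhds b, ∀ x ∈ Metric.sphere (0 : E) 1, 0 < ⟪s x, x⟫ := by
    refine (isCompact_sphere (0 : E) 1).eventually_forall_of_forall_eventually fun x hx => ?_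
    have hc : Continuous fun p : (E →L[ℝ] E) × E => ⟪p.1 p.2, p.2⟫ := by fun_prop
    exact hc.continuousAt.eventually (lt_mem_nhds (hb x (by rintro rfl; simp at hx)))
  filter_upwards [h1] with s hs x hx
  have hn : 0 < ‖x‖ := norm_pos_iff.2 hx
  have h2 := hs (‖x‖⁻¹ • x) (by simp [norm_smul, hn.ne'])
  rw [map_smul, inner_smul_left, inner_smul_right] at h2
  simp only [conj_trivial] at h2
  have h3 : 0 < ‖x‖⁻¹ := inv_pos.2 hn
  exact pos_of_mul_pos_right (pos_of_mul_pos_right h2 h3.le) h3.le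

theorem aux_fd {A : Type*} [NormedRing A] [NormedAlgebra ℝ A] (S : Submodule ℝ A)
    (P : A →L[ℝ] S) (b h : S) :
    fderiv ℝ (fun s : S => P ((s : A) * s)) b h = P ((b : A) * h + (h : A) * b) := by
  have hv : HasFDerivAt (fun s : S => (s : A)) S.subtypeL b := S.subtypeL.hasFDerivAt
  have h2 : HasFDerivAt (fun s : S => P ((s : A) * s)) _ b :=
    P.hasFDerivAt.comp b (hv.mul' hv)
  rw [h2.fderiv]
  simp

theorem aux_inv {G : Type*} [NormedAddCommGroup G] [NormedSpace ℝ G] [FiniteDimensional ℝ G]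
    (q : G → G) (b : G) (hq : AnalyticAt ℝ q b) (hinj : Function.Injective (fderiv ℝ q b)) :
    ∃ f : OpenPartialHomeomorph G G, (f : G → G) = q ∧ b ∈ f.source ∧
      AnalyticAt ℝ f.symm (q b) := by
  have : CompleteSpace G := FiniteDimensional.complete ℝ G
  have hder : HasStrictFDerivAt q (fderiv ℝ q b) b := hq.hasStrictFDerivAt
  let i : G ≃L[ℝ] G :=
    (LinearEquiv.ofInjectiveEndo (fderiv ℝ q b : G →ₗ[ℝ] G) hinj).toContinuousLinearEquiv
  have hi : (i : G →L[ℝ] G) = fderiv ℝ q b := by ext; rfl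
  rw [← hi] at hder
  have hbs := hder.mem_toOpenPartialHomeomorph_source
  exact ⟨hder.toOpenPartialHomeomorph q, rfl, hbs,
    (hder.toOpenPartialHomeomorph q).analyticAt_symm' (i := i) hbs hq hi.symm⟩

/-- Let `E` be a finite-dimensional real inner product space and let `S` be
the real normed space of self-adjoint (continuous linear) endomorphisms of `E`. The square-root
map `a ↦ a^{1/2}`, defined on the positive definite elements of `S` and sending `a` to its
unique positive definite self-adjoint square root, is real analytic: any map `sqrt : S → S`
realizing it is analytic at every positive definite self-adjoint endomorphism. -/
theorem sqrt_of_selfAdjoint_posDef_analyticAt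
    (E : Type*) [NormedAddCommGroup E] [InnerProductSpace ℝ E] [FiniteDimensional ℝ E]
    (S : Submodule ℝ (E →L[ℝ] E))
    (hS : ∀ T : E →L[ℝ] E, T ∈ S ↔ ∀ x y : E, ⟪T x, y⟫ = ⟪x, T y⟫)
    (sqrt : S → S)
    (hsqrt : ∀ a : S, (∀ x : E, x ≠ 0 → 0 < ⟪(a : E →L[ℝ] E) x, x⟫) →
      ((∀ x : E, x ≠ 0 → 0 < ⟪(sqrt a : E →L[ℝ] E) x, x⟫) ∧
        (sqrt a : E →L[ℝ] E).comp (sqrt a : E →L[ℝ] E) = (a : E →L[ℝ] E)))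
    (a : S) (ha : ∀ x : E, x ≠ 0 → 0 < ⟪(a : E →L[ℝ] E) x, x⟫) :
    AnalyticAt ℝ sqrt a := by
  obtain ⟨P₀, hP₀⟩ := LinearMap.exists_leftInverse_of_injective S.subtype S.ker_subtype
  let P : (E →L[ℝ] E) →L[ℝ] S := LinearMap.toContinuousLinearMap P₀
  have hP : ∀ (T : E →L[ℝ] E), T ∈ S → ((P T : S) : E →L[ℝ] E) = T := fun T hT =>
    congrArg Subtype.val (LinearMap.congr_fun hP₀ ⟨T, hT⟩)
  have hsq : ∀ s : S, (s : E →L[ℝ] E) * s ∈ S := fun s => (hS _).2 fun x y => by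
    have h := (hS _).1 s.2
    change ⟪(s : E →L[ℝ] E) ((s : E →L[ℝ] E) x), y⟫ = ⟪x, (s : E →L[ℝ] E) ((s : E →L[ℝ] E) y)⟫
    rw [h, h]
  obtain ⟨hb, hbb⟩ := hsqrt a ha
  let q : S → S := fun s => P ((s : E →L[ℝ] E) * s)
  have hq : ∀ s, ((q s : S) : E →L[ℝ] E) = (s : E →L[ℝ] E) * s := fun s => hP _ (hsq s)
  set b := sqrt a with hbdef
  have hqb : q b = a := Subtype.ext ((hq b).trans hbb)
  have hPan : ∀ T, AnalyticAt ℝ (P : (E →L[ℝ] E) → S) T := fun T =>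
    ContinuousLinearMap.analyticAt (𝕜 := ℝ) (E := E →L[ℝ] E) (F := S) P T
  have hval : ∀ s : S, AnalyticAt ℝ (S.subtypeL : S → (E →L[ℝ] E)) s := fun s =>
    ContinuousLinearMap.analyticAt (𝕜 := ℝ) (E := S) (F := E →L[ℝ] E) S.subtypeL s
  have hsqan : ∀ s : S, AnalyticAt ℝ (fun s : S => (s : E →L[ℝ] E) * s) s := fun s =>
    (hval s).mul (hval s)
  have hqan : ∀ s, AnalyticAt ℝ q s := fun s =>
    (hPan _).comp (hsqan s)
  have hfd : ∀ h : S, fderiv ℝ q b h = P ((b : E →L[ℝ] E) * h + (h : E →L[ℝ] E) * b) :=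
    fun h => aux_fd (A := E →L[ℝ] E) S P b h
  have hmem : ∀ h : S, (b : E →L[ℝ] E) * h + (h : E →L[ℝ] E) * b ∈ S := fun h => by
    have := S.sub_mem (S.sub_mem (hsq (b + h)) (hsq b)) (hsq h)
    convert this using 1
    push_cast
    noncomm_ring
  have hinj : Function.Injective (fderiv ℝ q b) := by
    rw [injective_iff_map_eq_zero]
    intro h hh
    rw [hfd] at hh
    have h0 : (b : E →L[ℝ] E) * h + (h : E →L[ℝ] E) * b = 0 := by
      rw [← hP _ (hmem h), hh]; rfl
    exact Subtype.ext (aux_sylv _ _ _ hb hb ((hS _).1 h.2) h0)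
  obtain ⟨f, hfq, hbs, han⟩ := aux_inv (G := S) q b (hqan b) hinj
  have hfa : f b = a := by rw [hfq]; exact hqb
  rw [hqb] at han
  have hat : a ∈ f.target := hfa ▸ f.map_source hbs
  have hsa : f.symm a = b := by rw [← hfa]; exact f.left_inv hbs
  refine han.congr ?_
  have hcont : Filter.Tendsto (fun x => ((f.symm x : S) : E →L[ℝ] E)) (nhds a) (nhds b) := by
    have := han.continuousAt
    rw [ContinuousAt, hsa] at this
    exact (continuous_subtype_val.tendsto b).comp this
  filter_upwards [hcont.eventually (aux_open _ hb), f.open_target.mem_nhds hat] with x hx hxt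
  have hqx : q (f.symm x) = x := by
    rw [← hfq]; exact f.right_inv hxt
  have hxe : (x : E →L[ℝ] E) = (f.symm x : E →L[ℝ] E) * f.symm x := by rw [← hq, hqx]
  generalize f.symm x = s at *
  have hsx := (hS _).1 s.2
  have hxpos : ∀ y : E, y ≠ 0 → 0 < ⟪(x : E →L[ℝ] E) y, y⟫ := by
    intro y hy
    rw [hxe]
    change 0 < ⟪(s : E →L[ℝ] E) ((s : E →L[ℝ] E) y), y⟫
    rw [hsx]
    refine real_inner_self_pos.2 fun h0 => ?_
    have := hx y hy
    rw [h0, inner_zero_left] at this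
    exact lt_irrefl _ this
  obtain ⟨h1, h2⟩ := hsqrt x hxpos
  have h2' : (sqrt x : E →L[ℝ] E) * sqrt x = s * s := h2.trans hxe
  have h3 : (s : E →L[ℝ] E) - sqrt x = 0 := by
    refine aux_sylv (s : E →L[ℝ] E) (sqrt x) _ hx h1 ((hS _).1 (S.sub_mem s.2 (sqrt x).2)) ?_
    rw [mul_sub, sub_mul, h2']; abel
  exact Subtype.ext (sub_eq_zero.1 h3)
end

section
/- Let E be a finite-dimensional real inner product space and let ε > 0. Suppose t ↦ a_t is a real analytic map from the interval (-ε, ε) into the endomorphisms of E such that for every t the endomorphism a_t is self-adjoint and positive definite. Then the map t ↦ (a_t)^{1/2}, sending t to the unique positive definite self-adjoint square root of a_t, is real analytic on (-ε, ε). -/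
open scoped RealInnerProductSpace

lemma sqrtfam_aux {E : Type*} [NormedAddCommGroup E] [InnerProductSpace ℝ E]
    (s : E →L[ℝ] E) (hs : ∀ x : E, x ≠ 0 → 0 < ⟪s x, x⟫) (l : ℝ) (w : E) :
    l * ‖w‖ ≤ ‖s w + l • w‖ := by
  by_cases hw : w = 0
  · simp [hw]
  have h1 := hs w hw
  have h2 : ⟪s w + l • w, w⟫ ≤ ‖s w + l • w‖ * ‖w‖ := real_inner_le_norm _ _
  rw [inner_add_left, real_inner_smul_left, real_inner_self_eq_norm_sq] at h2
  have h3 : 0 < ‖w‖ := norm_pos_iff.2 hw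
  by_contra! h
  nlinarith [mul_lt_mul_of_pos_right h h3]

lemma sqrtfam_basis {E : Type*} [NormedAddCommGroup E] [InnerProductSpace ℝ E]
    [FiniteDimensional ℝ E]
    (s : E →L[ℝ] E) (hsa : ∀ x y : E, ⟪s x, y⟫ = ⟪x, s y⟫)
    (hs : ∀ x : E, x ≠ 0 → 0 < ⟪s x, x⟫) :
    ∃ (n : ℕ) (b : Module.Basis (Fin n) ℝ E) (l : Fin n → ℝ),
      ∀ i, 0 < l i ∧ s (b i) = l i • b i := by
  have hsym : (s : E →ₗ[ℝ] E).IsSymmetric := hsa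
  refine ⟨_, (hsym.eigenvectorBasis rfl).toBasis, hsym.eigenvalues rfl, fun i => ?_⟩
  have he : s (hsym.eigenvectorBasis rfl i)
      = hsym.eigenvalues rfl i • hsym.eigenvectorBasis rfl i := by
    exact hsym.apply_eigenvectorBasis rfl i
  have hn : ‖hsym.eigenvectorBasis rfl i‖ = 1 := (hsym.eigenvectorBasis rfl).norm_eq_one i
  refine ⟨?_, by simpa using he⟩
  have h := hs (hsym.eigenvectorBasis rfl i) (by rw [← norm_ne_zero_iff, hn]; norm_num)
  rw [he, real_inner_smul_left, real_inner_self_eq_norm_sq, hn] at h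
  simpa using h

/-- Let `E` be a finite-dimensional real inner product space and `ε > 0`.
If `t ↦ a t` is a real analytic family on `(-ε, ε)` of self-adjoint positive definite
endomorphisms of `E`, then the family `t ↦ (a t)^{1/2}` of unique positive definite
self-adjoint square roots is real analytic on `(-ε, ε)`. -/
theorem sqrt_family_analytic
    (E : Type*) [NormedAddCommGroup E] [InnerProductSpace ℝ E] [FiniteDimensional ℝ E]
    (ε : ℝ) (hε : 0 < ε)
    (a : ℝ → E →L[ℝ] E)
    (ha_an : ∀ t ∈ Set.Ioo (-ε) ε, AnalyticAt ℝ a t)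
    (ha_sa : ∀ t ∈ Set.Ioo (-ε) ε, ∀ x y : E, ⟪a t x, y⟫ = ⟪x, a t y⟫)
    (ha_pd : ∀ t ∈ Set.Ioo (-ε) ε, ∀ x : E, x ≠ 0 → 0 < ⟪a t x, x⟫)
    -- `s t` is the unique positive definite self-adjoint square root of `a t`
    (s : ℝ → E →L[ℝ] E)
    (hs_sa : ∀ t ∈ Set.Ioo (-ε) ε, ∀ x y : E, ⟪s t x, y⟫ = ⟪x, s t y⟫)
    (hs_pd : ∀ t ∈ Set.Ioo (-ε) ε, ∀ x : E, x ≠ 0 → 0 < ⟪s t x, x⟫)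
    (hs_sq : ∀ t ∈ Set.Ioo (-ε) ε, (s t).comp (s t) = a t) :
    ∀ t ∈ Set.Ioo (-ε) ε, AnalyticAt ℝ s t := by
  intro t₀ ht₀
  have hnhds : ∀ᶠ t in nhds t₀, t ∈ Set.Ioo (-ε) ε := Ioo_mem_nhds ht₀.1 ht₀.2
  obtain ⟨n, b, l, hb⟩ := sqrtfam_basis (s t₀) (hs_sa t₀ ht₀) (hs_pd t₀ ht₀)
  -- continuity
  have hcont : ContinuousAt s t₀ := by
    obtain ⟨C, hC, hCb⟩ := b.exists_opNorm_le (F := E)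
    have key : ∀ t ∈ Set.Ioo (-ε) ε,
        ‖s t - s t₀‖ ≤ C * ∑ i, (l i)⁻¹ * (‖a t - a t₀‖ * ‖b i‖) := by
      intro t ht
      have hnn : ∀ i, 0 ≤ (l i)⁻¹ * (‖a t - a t₀‖ * ‖b i‖) := fun i =>
        mul_nonneg (inv_nonneg.2 (hb i).1.le) (by positivity)
      refine hCb (Finset.sum_nonneg fun i _ => hnn i) fun i => ?_
      refine le_trans ?_ (Finset.single_le_sum (fun i _ => hnn i) (Finset.mem_univ i))
      have h1 := sqrtfam_aux (s t) (hs_pd t ht) (l i) ((s t - s t₀) (b i))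
      have h2 : s t ((s t - s t₀) (b i)) + l i • (s t - s t₀) (b i)
          = (a t - a t₀) (b i) := by
        rw [← hs_sq t ht, ← hs_sq t₀ ht₀]
        simp only [sub_apply, ContinuousLinearMap.comp_apply, (hb i).2,
          map_sub, map_smul, smul_sub]
        abel
      rw [h2] at h1
      rw [inv_mul_eq_div, le_div_iff₀ (hb i).1, mul_comm]
      exact h1.trans (ContinuousLinearMap.le_opNorm _ _)
    rw [ContinuousAt, tendsto_iff_norm_sub_tendsto_zero]
    refine squeeze_zero' (Filter.Eventually.of_forall fun t => norm_nonneg _)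
      (hnhds.mono key) ?_
    have hca : ContinuousAt
        (fun t => C * ∑ i, (l i)⁻¹ * (‖a t - a t₀‖ * ‖b i‖)) t₀ := by
      have := (ha_an t₀ ht₀).continuousAt
      fun_prop
    simpa [ContinuousAt] using hca
  -- derivative of squaring
  let f : (E →L[ℝ] E) → (E →L[ℝ] E) := fun x => x * x
  have hf : AnalyticAt ℝ f (s t₀) := analyticAt_id.mul analyticAt_id
  let L : (E →L[ℝ] E) →L[ℝ] (E →L[ℝ] E) := fderiv ℝ f (s t₀)
  have hLa : ∀ h, L h = s t₀ * h + h * s t₀ := by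
    intro h
    have h1 : HasFDerivAt f _ (s t₀) :=
      (hasFDerivAt_id (𝕜 := ℝ) (s t₀)).mul' (hasFDerivAt_id (s t₀))
    simp [L, h1.fderiv]
  have hinj : Function.Injective L := by
    rw [injective_iff_map_eq_zero]
    intro h hh
    rw [hLa] at hh
    refine ContinuousLinearMap.coe_injective (b.ext fun i => ?_)
    have h1 := sqrtfam_aux (s t₀) (hs_pd t₀ ht₀) (l i) (h (b i))
    have h2 : s t₀ (h (b i)) + l i • h (b i) = 0 := by
      have := DFunLike.congr_fun hh (b i)
      simpa [(hb i).2] using this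
    rw [h2, norm_zero] at h1
    have h3 : ‖h (b i)‖ ≤ 0 := by
      by_contra! h4
      nlinarith [mul_pos (hb i).1 h4]
    simpa using h3
  let i : (E →L[ℝ] E) ≃L[ℝ] (E →L[ℝ] E) :=
    (LinearEquiv.ofInjectiveEndo (L : (E →L[ℝ] E) →ₗ[ℝ] (E →L[ℝ] E)) hinj).toContinuousLinearEquiv
  have hi : (i : (E →L[ℝ] E) →L[ℝ] (E →L[ℝ] E)) = L := by
    ext1 x
    rfl
  have hfd : HasStrictFDerivAt f (i : (E →L[ℝ] E) →L[ℝ] (E →L[ℝ] E)) (s t₀) := by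
    rw [hi]
    exact hf.hasStrictFDerivAt
  let R := hfd.toOpenPartialHomeomorph f
  have hx : s t₀ ∈ R.source := hfd.mem_toOpenPartialHomeomorph_source
  have hR : AnalyticAt ℝ R.symm (f (s t₀)) :=
    R.analyticAt_symm' hx hf hi.symm
  have hfa : f (s t₀) = a t₀ := hs_sq t₀ ht₀
  rw [hfa] at hR
  refine (hR.comp (ha_an t₀ ht₀)).congr ?_
  have hev := hcont.eventually (R.open_source.mem_nhds hx)
  filter_upwards [hnhds, hev] with t ht hts
  have h1 : R (s t) = a t := hs_sq t ht
  simp only [Function.comp]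
  rw [← h1]
  exact R.left_inv hts
end

section
/- Let V be a finite-dimensional real vector space, let g be a fixed inner product on V, let ε > 0, and suppose t ↦ h_t is a real analytic map from (-ε, ε) into the space of symmetric bilinear forms on V such that each h_t is an inner product. For each t let a_t be the Bourguignou–Gauduchon endomorphism of the pair (g, h_t), i.e. the unique endomorphism with h_t(x,y) = g(a_t x, y) for all x, y ∈ V, and set b_t := ((a_t)^{1/2})⁻¹, the inverse of the unique positive definite g-self-adjoint square root of a_t. Then the map t ↦ b_t is real analytic on (-ε, ε). -/
theorem bg_sylvester_zero {V : Type*} [AddCommGroup V] [Module ℝ V] [FiniteDimensional ℝ V]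
    (g : V → V → ℝ) (hadd : ∀ x y z, g (x + y) z = g x z + g y z)
    (hsmul : ∀ (r : ℝ) x y, g (r • x) y = r * g x y)
    (hsymm : ∀ x y, g x y = g y x) (hpos : ∀ x, x ≠ 0 → 0 < g x x)
    (P Q H : V →ₗ[ℝ] V)
    (hP : ∀ x, x ≠ 0 → 0 < g (P x) x)
    (hQsa : ∀ x y, g (Q x) y = g x (Q y)) (hQ : ∀ x, x ≠ 0 → 0 < g (Q x) x)
    (hH : ∀ x, P (H x) + H (Q x) = 0) : H = 0 := by
  have h0 : ∀ y, g 0 y = 0 := fun y => by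
    have := hsmul 0 0 y
    simpa using this
  let c : InnerProductSpace.Core ℝ V :=
    { inner := g
      conj_inner_symm := fun x y => by simpa using hsymm y x
      re_inner_nonneg := fun x => by
        by_cases hx : x = 0
        · subst hx; simp [h0]
        · simpa using (hpos x hx).le
      add_left := hadd
      smul_left := fun x y r => by simpa using hsmul r x y
      definite := fun x hx => by
        by_contra hne
        exact (hpos x hne).ne' hx }
  let _ : NormedAddCommGroup V := c.toNormedAddCommGroup
  let _ : InnerProductSpace ℝ V := InnerProductSpace.ofCore c.toCore
  have hsym : Q.IsSymmetric := fun x y => hQsa x y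
  refine (hsym.eigenvectorBasis rfl).toBasis.ext fun i => ?_
  rw [OrthonormalBasis.coe_toBasis]
  have hv := hsym.apply_eigenvectorBasis rfl i
  have hne : hsym.eigenvectorBasis rfl i ≠ 0 := by
    have := (hsym.eigenvectorBasis rfl).toBasis.ne_zero i
    rwa [OrthonormalBasis.coe_toBasis] at this
  generalize hsym.eigenvectorBasis rfl i = v at hv hne
  generalize hsym.eigenvalues rfl i = μ at hv
  simp only [RCLike.ofReal_real_eq_id, id] at hv
  have h1 := hQ v hne
  rw [hv, hsmul] at h1
  have hμ : 0 < μ := by nlinarith [hpos v hne]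
  by_contra hHv
  have hHv' : H v ≠ 0 := by simpa using hHv
  have h2 := hP _ hHv'
  have h3 : P (H v) = (-μ) • H v := by
    have := hH v
    rw [hv, map_smul] at this
    rw [neg_smul]
    exact eq_neg_of_add_eq_zero_left this
  rw [h3, hsmul] at h2
  nlinarith [hpos _ hHv']

theorem bg_pos_open {V : Type*} [NormedAddCommGroup V] [NormedSpace ℝ V] [FiniteDimensional ℝ V]
    (g : V →L[ℝ] V →L[ℝ] ℝ) (S : V →L[ℝ] V) (hS : ∀ x, x ≠ 0 → 0 < g (S x) x) :
    ∀ᶠ P in nhds S, ∀ x, x ≠ 0 → 0 < g (P x) x := by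
  have hK : IsCompact (Metric.sphere (0 : V) 1) :=
    haveI := FiniteDimensional.proper ℝ V
    isCompact_sphere 0 1
  have key : ∀ᶠ P in nhds S, ∀ x ∈ Metric.sphere (0 : V) 1, 0 < g (P x) x := by
    apply hK.eventually_forall_of_forall_eventually
    intro x hx
    have hc : Continuous fun z : (V →L[ℝ] V) × V => g (z.1 z.2) z.2 := by fun_prop
    refine hc.continuousAt.eventually (lt_mem_nhds ?_)
    exact hS x (by rintro rfl; simp at hx)
  filter_upwards [key] with P hP x hx
  have hn : 0 < ‖x‖ := norm_pos_iff.2 hx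
  have := hP (‖x‖⁻¹ • x) (by simp [norm_smul, hn.ne'])
  simp only [map_smul, smul_apply, smul_eq_mul] at this
  have h2 : 0 < ‖x‖⁻¹ := inv_pos.2 hn
  exact (pos_iff_pos_of_mul_pos (by simpa using this)).1 h2 |> fun h => (pos_iff_pos_of_mul_pos h).1 h2


/-- Let `V` be a finite-dimensional real vector space with a fixed inner
product `g`, let `ε > 0`, and let `t ↦ h t` be a real analytic family on `(-ε, ε)` of
symmetric bilinear forms on `V`, each of which is an inner product. For each `t` let
`a t` be the Bourguignon–Gauduchon endomorphism of `(g, h t)`, let `s t = (a t)^{1/2}` be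
its unique positive definite `g`-self-adjoint square root, and let `b t := (s t)⁻¹`.
Then `t ↦ b t` is real analytic on `(-ε, ε)`.
(Bilinear forms and endomorphisms are represented by continuous (ℝ-bi)linear maps; in
finite dimension every linear map is continuous, so nothing is lost.) -/
theorem bourguignon_gauduchon_b_family_analytic
    (V : Type*) [NormedAddCommGroup V] [NormedSpace ℝ V] [FiniteDimensional ℝ V]
    (g : V →L[ℝ] V →L[ℝ] ℝ)
    (hg_symm : ∀ x y : V, g x y = g y x)
    (hg_pos : ∀ x : V, x ≠ 0 → 0 < g x x)
    (ε : ℝ) (hε : 0 < ε)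
    (h : ℝ → V →L[ℝ] V →L[ℝ] ℝ)
    (hh_an : ∀ t ∈ Set.Ioo (-ε) ε, AnalyticAt ℝ h t)
    (hh_symm : ∀ t ∈ Set.Ioo (-ε) ε, ∀ x y : V, h t x y = h t y x)
    (hh_pos : ∀ t ∈ Set.Ioo (-ε) ε, ∀ x : V, x ≠ 0 → 0 < h t x x)
    -- `a t` is the Bourguignon–Gauduchon endomorphism of the pair `(g, h t)`
    (a : ℝ → V →L[ℝ] V)
    (ha : ∀ t ∈ Set.Ioo (-ε) ε, ∀ x y : V, h t x y = g (a t x) y)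
    -- `s t` is the unique positive definite `g`-self-adjoint square root of `a t`
    (s : ℝ → V →L[ℝ] V)
    (hs_sa : ∀ t ∈ Set.Ioo (-ε) ε, ∀ x y : V, g (s t x) y = g x (s t y))
    (hs_pd : ∀ t ∈ Set.Ioo (-ε) ε, ∀ x : V, x ≠ 0 → 0 < g (s t x) x)
    (hs_sq : ∀ t ∈ Set.Ioo (-ε) ε, (s t).comp (s t) = a t)
    -- `b t` is the inverse of `s t`
    (b : ℝ → V →L[ℝ] V)
    (hbs : ∀ t ∈ Set.Ioo (-ε) ε, (b t).comp (s t) = ContinuousLinearMap.id ℝ V)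
    (hsb : ∀ t ∈ Set.Ioo (-ε) ε, (s t).comp (b t) = ContinuousLinearMap.id ℝ V) :
    ∀ t ∈ Set.Ioo (-ε) ε, AnalyticAt ℝ b t := by
  intro t₀ ht₀
  have syl : ∀ P Q H : V →L[ℝ] V, (∀ x, x ≠ 0 → 0 < g (P x) x) →
      (∀ x y, g (Q x) y = g x (Q y)) → (∀ x, x ≠ 0 → 0 < g (Q x) x) →
      P * H + H * Q = 0 → H = 0 := by
    intro P Q H hP hQsa hQ hH
    have := bg_sylvester_zero (fun x y => g x y) (by simp) (by simp) hg_symm hg_pos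
      (P : V →ₗ[ℝ] V) (Q : V →ₗ[ℝ] V) (H : V →ₗ[ℝ] V) hP hQsa hQ
      (fun x => by simpa using DFunLike.congr_fun hH x)
    ext x
    simpa using DFunLike.congr_fun this x
  have hnhds : ∀ᶠ t in nhds t₀, t ∈ Set.Ioo (-ε) ε := isOpen_Ioo.mem_nhds ht₀
  -- `a` is analytic
  have ha_an : AnalyticAt ℝ a t₀ := by
    obtain ⟨K, hK⟩ := LinearMap.exists_leftInverse_of_injective (g : V →ₗ[ℝ] V →L[ℝ] ℝ) (by
      rw [LinearMap.ker_eq_bot']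
      intro x hx
      by_contra hne
      have h1 := hg_pos x hne
      have h2 : g x = 0 := hx
      simp [h2] at h1)
    let K' : (V →L[ℝ] ℝ) →L[ℝ] V := LinearMap.toContinuousLinearMap K
    let M : (V →L[ℝ] V →L[ℝ] ℝ) →L[ℝ] (V →L[ℝ] V) := ContinuousLinearMap.compL ℝ V (V →L[ℝ] ℝ) V K'
    have h1 : AnalyticAt ℝ (fun t => M (h t)) t₀ :=
      AnalyticAt.comp (g := fun x => M x) (ContinuousLinearMap.analyticAt (𝕜 := ℝ) M (h t₀)) (hh_an t₀ ht₀)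
    refine h1.congr ?_
    filter_upwards [hnhds] with t ht
    ext x
    have h2 : h t x = g (a t x) := by
      ext y
      exact ha t ht x y
    simpa [M, K', h2] using DFunLike.congr_fun hK (a t x)
  -- inverse function theorem for squaring
  let F : (V →L[ℝ] V) → (V →L[ℝ] V) := fun X => X * X
  let L : (V →L[ℝ] V) →L[ℝ] (V →L[ℝ] V) :=
    (ContinuousLinearMap.mul ℝ (V →L[ℝ] V)) (s t₀) +
      (ContinuousLinearMap.mul ℝ (V →L[ℝ] V)).flip (s t₀)
  have hLinj : Function.Injective (L : (V →L[ℝ] V) →ₗ[ℝ] (V →L[ℝ] V)) := by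
    rw [← LinearMap.ker_eq_bot, LinearMap.ker_eq_bot']
    intro H hH
    exact syl (s t₀) (s t₀) H (hs_pd t₀ ht₀) (hs_sa t₀ ht₀) (hs_pd t₀ ht₀) hH
  let e : (V →L[ℝ] V) ≃L[ℝ] (V →L[ℝ] V) :=
    (LinearEquiv.ofInjectiveEndo (L : (V →L[ℝ] V) →ₗ[ℝ] (V →L[ℝ] V)) hLinj).toContinuousLinearEquiv
  have heL : (e : (V →L[ℝ] V) →L[ℝ] (V →L[ℝ] V)) = L := by
    ext1 H
    rfl
  have hF : HasStrictFDerivAt F (e : (V →L[ℝ] V) →L[ℝ] (V →L[ℝ] V)) (s t₀) := by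
    rw [heL]
    have := (hasStrictFDerivAt_id (𝕜 := ℝ) (s t₀)).mul' (hasStrictFDerivAt_id (𝕜 := ℝ) (s t₀))
    refine this.congr_fderiv ?_
    ext1 H
    simp [L]
  have hFa : F (s t₀) = a t₀ := hs_sq t₀ ht₀
  have hFan : AnalyticAt ℝ F (s t₀) := analyticAt_id.mul analyticAt_id
  have hinv : AnalyticAt ℝ (hF.localInverse F e (s t₀)) (F (s t₀)) :=
    (hF.toOpenPartialHomeomorph F).analyticAt_symm' hF.mem_toOpenPartialHomeomorph_source
      hFan hF.hasFDerivAt.fderiv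
  have hr := hF.eventually_right_inverse
  have hl := hF.localInverse_apply_image
  rw [hFa] at hinv hr hl
  have hσ : AnalyticAt ℝ (fun t => hF.localInverse F e (s t₀) (a t)) t₀ := hinv.comp ha_an
  have hs_an : AnalyticAt ℝ s t₀ := by
    refine hσ.congr ?_
    have hpos := hσ.continuousAt.eventually (by
      simpa only [hl] using bg_pos_open g (s t₀) (hs_pd t₀ ht₀))
    filter_upwards [hnhds, hpos, ha_an.continuousAt.eventually hr] with t ht hp hrt
    generalize hF.localInverse F e (s t₀) (a t) = P at hp hrt
    have h1 : P * P = a t := hrt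
    have h2 : s t * s t = a t := hs_sq t ht
    refine sub_eq_zero.1 (syl P (s t) (P - s t) hp (hs_sa t ht) (hs_pd t ht) ?_)
    rw [mul_sub, sub_mul, h1, h2]
    abel
  -- inversion
  let u : (V →L[ℝ] V)ˣ := ⟨s t₀, b t₀, hsb t₀ ht₀, hbs t₀ ht₀⟩
  have hb : AnalyticAt ℝ (fun t => Ring.inverse (s t)) t₀ :=
    (show AnalyticAt ℝ Ring.inverse (s t₀) from analyticAt_inverse u).comp hs_an
  refine hb.congr ?_
  filter_upwards [hnhds] with t ht
  let w : (V →L[ℝ] V)ˣ := ⟨s t, b t, hsb t ht, hbs t ht⟩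
  exact Ring.inverse_unit w
end

section
/- Let n ≥ 1, let Q be the quadratic form on Euclidean space ℝⁿ given by Q(v) = -‖v‖², let ι : ℝⁿ → Cl(Q) be the canonical linear embedding into the Clifford algebra of Q, and let (e₁, …, e_n) be the standard orthonormal basis of ℝⁿ. For j = 1, …, n define f_j : ℝⁿ ∖ {0} → ℝ by f_j(x) = x_j / ‖x‖ⁿ. Then for every x ≠ 0, the element Σ_{i,j} (∂f_j/∂x_i)(x) · ι(e_i) * ι(e_j) of Cl(Q) is zero. (This expresses that the singular part -x·ψ₀/(ω_{n-1}‖x‖ⁿ) of the Green's function of the flat Dirac operator is harmonic away from the origin.) -/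
theorem aux_norm_deriv {n : ℕ} (x : EuclideanSpace ℝ (Fin n)) (hx : x ≠ 0) :
    ∃ N : EuclideanSpace ℝ (Fin n) →L[ℝ] ℝ,
      HasFDerivAt (fun y : EuclideanSpace ℝ (Fin n) => ‖y‖) N x ∧
        ∀ v, ‖x‖ * N v = inner ℝ x v := by
  have hd : DifferentiableAt ℝ (fun y : EuclideanSpace ℝ (Fin n) => ‖y‖) x :=
    (contDiffAt_norm ℝ hx (n := 1)).differentiableAt (by norm_num)
  refine ⟨_, hd.hasFDerivAt, fun v => ?_⟩
  have h1 := hd.hasFDerivAt.pow 2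
  have h2 := (hasStrictFDerivAt_norm_sq x).hasFDerivAt
  have h3 := congrArg (fun L => L v) (h1.unique h2)
  simp at h3
  linarith

theorem aux_fderiv {n : ℕ} (hn : 1 ≤ n) (x : EuclideanSpace ℝ (Fin n)) (hx : x ≠ 0)
    (g : EuclideanSpace ℝ (Fin n) → ℝ) (j : Fin n) (hg : ∀ y, g y = y j / ‖y‖ ^ n)
    (i : Fin n) :
    fderiv ℝ g x (EuclideanSpace.single i 1) =
      (if i = j then (‖x‖ ^ n)⁻¹ else 0) - n * (‖x‖ ^ (n + 2))⁻¹ * (x i * x j) := by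
  obtain ⟨N, hN, hNv⟩ := aux_norm_deriv x hx
  have hr : ‖x‖ ≠ 0 := norm_ne_zero_iff.2 hx
  have hp : HasFDerivAt (fun y : EuclideanSpace ℝ (Fin n) => y j)
      (EuclideanSpace.proj j : EuclideanSpace ℝ (Fin n) →L[ℝ] ℝ) x :=
    (EuclideanSpace.proj j : EuclideanSpace ℝ (Fin n) →L[ℝ] ℝ).hasFDerivAt
  have hq := hN.pow n
  have hq2 := (hasDerivAt_inv (𝕜 := ℝ) (pow_ne_zero n hr)).comp_hasFDerivAt x hq
  have hm := hp.mul hq2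
  have e : g = fun y => y j * (‖y‖ ^ n)⁻¹ := by
    funext y; rw [hg, div_eq_mul_inv]
  have hm' := hm
  change HasFDerivAt (fun y : EuclideanSpace ℝ (Fin n) => y j * (‖y‖ ^ n)⁻¹) _ x at hm'
  rw [← e] at hm'
  rw [hm'.fderiv]
  have hv := hNv (EuclideanSpace.single i 1)
  have hv' : N (EuclideanSpace.single i 1) = x i / ‖x‖ := by
    rw [eq_div_iff hr, mul_comm, hv, EuclideanSpace.inner_single_right]; simp
  obtain ⟨m, rfl⟩ : ∃ m, n = m + 1 := ⟨n - 1, by omega⟩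
  by_cases hij : i = j
  · subst hij
    simp [hv']
    field_simp
    ring
  · simp [hv', hij, Ne.symm hij]
    field_simp
    ring

/-- Let `Q` be the quadratic form `Q v = -‖v‖²` on Euclidean space `ℝⁿ`
(`n ≥ 1`), let `ι` be the canonical embedding of `ℝⁿ` into the Clifford algebra `Cl(Q)`, and
let `e i = EuclideanSpace.single i 1` be the standard orthonormal basis. For `f j x = x j / ‖x‖ⁿ`
and every `x ≠ 0`, the Clifford algebra element `Σ_{i,j} (∂f_j/∂x_i)(x) • ι(e i) * ι(e j)`
vanishes: the singular part of the Green's function of the flat Dirac operator is harmonic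
away from the origin. -/
theorem flat_dirac_green_singular_part_harmonic
    (n : ℕ) (hn : 1 ≤ n)
    (Q : QuadraticForm ℝ (EuclideanSpace ℝ (Fin n)))
    (hQ : ∀ v : EuclideanSpace ℝ (Fin n), Q v = -‖v‖ ^ 2)
    (f : Fin n → EuclideanSpace ℝ (Fin n) → ℝ)
    (hf : ∀ (j : Fin n) (x : EuclideanSpace ℝ (Fin n)), f j x = x j / ‖x‖ ^ n)
    (x : EuclideanSpace ℝ (Fin n)) (hx : x ≠ 0) :
    ∑ i : Fin n, ∑ j : Fin n,
      fderiv ℝ (f j) x (EuclideanSpace.single i 1) •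
        (CliffordAlgebra.ι Q (EuclideanSpace.single i 1) *
          CliffordAlgebra.ι Q (EuclideanSpace.single j 1)) = 0 := by
  have hι : ∑ i : Fin n, x i • CliffordAlgebra.ι Q (EuclideanSpace.single i 1) =
      CliffordAlgebra.ι Q x := by
    conv_rhs => rw [← (EuclideanSpace.basisFun (Fin n) ℝ).sum_repr x]
    simp
  have hsq : ∑ i : Fin n, ∑ j : Fin n, (x i * x j) •
      (CliffordAlgebra.ι Q (EuclideanSpace.single i 1) *
          CliffordAlgebra.ι Q (EuclideanSpace.single j 1)) =
      algebraMap ℝ (CliffordAlgebra Q) (-‖x‖ ^ 2) := by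
    rw [← hQ, ← CliffordAlgebra.ι_sq_scalar, ← hι, Finset.sum_mul_sum]
    simp only [smul_mul_smul_comm]
  have he : ∀ i : Fin n, CliffordAlgebra.ι Q (EuclideanSpace.single i 1) *
      CliffordAlgebra.ι Q (EuclideanSpace.single i 1) = algebraMap ℝ (CliffordAlgebra Q) (-1) := by
    intro i
    rw [CliffordAlgebra.ι_sq_scalar, hQ]
    simp
  have hr : ‖x‖ ≠ 0 := norm_ne_zero_iff.2 hx
  simp_rw [fun i j => aux_fderiv hn x hx (f j) j (hf j) i, sub_smul, Finset.sum_sub_distrib,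
    mul_smul (_ * _ : ℝ) (_ * _ : ℝ), ← Finset.smul_sum, hsq, ite_smul, zero_smul,
    Finset.sum_ite_eq, Finset.mem_univ, if_true, he, Algebra.algebraMap_eq_smul_one, smul_smul,
    Finset.sum_const, Finset.card_univ, Fintype.card_fin, ← Nat.cast_smul_eq_nsmul ℝ, smul_smul,
    ← sub_smul]
  have : (n : ℝ) * ((‖x‖ ^ n)⁻¹ * -1) - n * (‖x‖ ^ (n + 2))⁻¹ * -‖x‖ ^ 2 = 0 := by
    field_simp
    ring
  rw [this, zero_smul]
end
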